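/- The number of monomials of degree j in the Feichtner–Yuzvinsky basis FY(B_n) equals the Eulerian number A(n,j), the number of permutations of [n] with exactly j descents. -/

import Mathlib

open scoped Classical

/-- An element of the Feichtner–Yuzvinsky basis `FY(B_n)`: a chain
`∅ = F_0 ⊊ F_1 ⊊ ⋯ ⊊ F_ℓ ⊆ [n]` with exponents `1 ≤ a_i ≤ |F_i| - |F_{i-1}| - 1`. -/
structure FYMonomial (n : ℕ) where
  len : ℕ
  F : Fin len → Finset (Fin n)
  a : Fin len → ℕ
  chain : ∀ i j : Fin len, i < j → F i ⊂ F j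
  a_pos : ∀ i : Fin len, 1 ≤ a i
  a_le_first : ∀ i : Fin len, (i : ℕ) = 0 → a i + 1 ≤ (F i).card
  a_le : ∀ i : Fin len, 0 < (i : ℕ) →
    a i + (F ⟨(i : ℕ) - 1, lt_of_le_of_lt (Nat.sub_le _ _) i.isLt⟩).card + 1 ≤ (F i).card

/-- The degree of an FY-basis monomial. -/
def FYdeg {n : ℕ} (m : FYMonomial n) : ℕ := ∑ i, m.a i

/-- The number of descents of a permutation of `[n]`. -/
def desNum {n : ℕ} (σ : Equiv.Perm (Fin n)) : ℕ :=
  ((Finset.range n).filter (fun i =>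
    ∃ h : i + 1 < n, σ ⟨i + 1, h⟩ < σ ⟨i, Nat.lt_of_succ_lt h⟩)).card

open Polynomial

/-- The binomial transform of `f`: `binomTransform c f n = ∑ i, n.choose i * c ^ i * f (n - i)`. -/
def binomTransform {R : Type*} [CommRing R] (c : R) : (ℕ → R) → ℕ → R
  | f, 0 => f 0
  | f, n + 1 => c * binomTransform c f n + binomTransform c (fun i => f (i + 1)) n

section BinomTransform

variable {R : Type*} [CommRing R]

lemma binomTransform_add (c : R) (f g : ℕ → R) (n : ℕ) :
    binomTransform c (fun i => f i + g i) n = binomTransform c f n + binomTransform c g n := by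
  induction n generalizing f g with
  | zero => simp [binomTransform]
  | succ n ih =>
    simp only [binomTransform]
    rw [ih f g, ih (fun i => f (i + 1)) (fun i => g (i + 1))]
    ring

lemma binomTransform_const_mul (c d : R) (f : ℕ → R) (n : ℕ) :
    binomTransform c (fun i => d * f i) n = d * binomTransform c f n := by
  induction n generalizing f with
  | zero => simp [binomTransform]
  | succ n ih =>
    simp only [binomTransform]
    rw [ih f, ih (fun i => f (i + 1))]
    ring

lemma binomTransform_binomTransform (c d : R) (f : ℕ → R) (n : ℕ) :
    binomTransform c (binomTransform d f) n = binomTransform (c + d) f n := by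
  induction n generalizing f with
  | zero => simp [binomTransform]
  | succ n ih =>
    have h : (fun i => binomTransform d f (i + 1)) =
        fun i => d * binomTransform d f i + binomTransform d (fun i => f (i + 1)) i := rfl
    rw [binomTransform, h, binomTransform_add, binomTransform_const_mul, ih, ih, binomTransform]
    ring

lemma binomTransform_zero (c : R) (n : ℕ) : binomTransform c (fun _ => 0) n = 0 := by
  simpa using binomTransform_const_mul c 0 (fun _ => 0) n

lemma binomTransform_single (c : R) (n : ℕ) :
    binomTransform c (fun i => if i = 0 then 1 else 0) n = c ^ n := by
  induction n with
  | zero => simp [binomTransform]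
  | succ n ih => simp [binomTransform, ih, binomTransform_zero, pow_succ']

lemma binomTransform_eq_sum (c : R) (f : ℕ → R) (n : ℕ) :
    binomTransform c f n =
      ∑ i ∈ Finset.range (n + 1), (n.choose i : R) * (c ^ i * f (n - i)) := by
  induction n generalizing f with
  | zero => simp [binomTransform]
  | succ n ih =>
    rw [binomTransform, ih, ih, Finset.sum_range_succ' _ (n + 1)]
    simp only [Nat.choose_succ_succ, Nat.cast_add, add_mul, Finset.sum_add_distrib, add_assoc]
    congr 1
    · rw [Finset.mul_sum]
      refine Finset.sum_congr rfl fun i _ => ?_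
      rw [Nat.add_sub_add_right]
      ring
    · rw [Finset.sum_range_succ' _ n, Finset.sum_range_succ _ n]
      simp only [Nat.choose_succ_self, Nat.cast_zero, zero_mul, add_zero]
      congr 1
      · refine Finset.sum_congr rfl fun i hi => ?_
        rw [Finset.mem_range] at hi
        congr 3
        omega
      · simp

end BinomTransform

/-- The permutation with first value `k` whose remaining values are order-isomorphic to `τ`. -/
def consPerm {n : ℕ} (k : Fin (n + 1)) (τ : Equiv.Perm (Fin n)) : Equiv.Perm (Fin (n + 1)) :=
  (finSuccEquiv n).trans ((Equiv.optionCongr τ).trans (finSuccEquiv' k).symm)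

@[simp]
lemma consPerm_zero {n : ℕ} (k : Fin (n + 1)) (τ : Equiv.Perm (Fin n)) : consPerm k τ 0 = k := by
  simp [consPerm]

@[simp]
lemma consPerm_succ {n : ℕ} (k : Fin (n + 1)) (τ : Equiv.Perm (Fin n)) (i : Fin n) :
    consPerm k τ i.succ = k.succAbove (τ i) := by
  simp [consPerm]

lemma consPerm_bijective (n : ℕ) :
    Function.Bijective fun p : Fin (n + 1) × Equiv.Perm (Fin n) => consPerm p.1 p.2 := by
  rw [Fintype.bijective_iff_injective_and_card]
  refine ⟨?_, by simp [Fintype.card_perm, Nat.factorial_succ]⟩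
  rintro ⟨k, τ⟩ ⟨l, υ⟩ h
  have hk : k = l := by simpa using DFunLike.congr_fun h 0
  subst hk
  congr 1
  ext1 i
  simpa using DFunLike.congr_fun h i.succ

lemma desNum_consPerm {n : ℕ} (k : Fin (n + 1)) (τ : Equiv.Perm (Fin n)) :
    desNum (consPerm k τ) =
      desNum τ + if ∃ h : 0 < n, (τ ⟨0, h⟩ : ℕ) < k then 1 else 0 := by
  rw [desNum, desNum, Finset.card_filter, Finset.card_filter, Finset.sum_range_succ']
  congr 1
  · refine Finset.sum_congr rfl fun i _ => if_congr ?_ rfl rfl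
    have key (h : i + 1 < n) :
        consPerm k τ ⟨i + 1 + 1, by omega⟩ < consPerm k τ ⟨i + 1, by omega⟩ ↔
          τ ⟨i + 1, h⟩ < τ ⟨i, by omega⟩ := by
      have h1 := consPerm_succ k τ ⟨i + 1, h⟩
      have h2 := consPerm_succ k τ ⟨i, by omega⟩
      simp only [Fin.succ_mk] at h1 h2
      rw [h1, h2, Fin.succAbove_lt_succAbove_iff]
    exact ⟨fun ⟨h, h'⟩ => ⟨by omega, (key (by omega)).1 h'⟩,
      fun ⟨h, h'⟩ => ⟨by omega, (key h).2 h'⟩⟩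
  · refine if_congr ?_ rfl rfl
    have key (h : 0 < n) : consPerm k τ ⟨0 + 1, by omega⟩ < consPerm k τ ⟨0, by omega⟩ ↔
        (τ ⟨0, h⟩ : ℕ) < k := by
      have h1 := consPerm_succ k τ ⟨0, h⟩
      have h2 := consPerm_zero k τ
      simp only [Fin.succ_mk] at h1
      rw [h1, show (⟨0, by omega⟩ : Fin (n + 1)) = 0 from rfl, h2,
        Fin.succAbove_lt_iff_castSucc_lt]
      rfl
    exact ⟨fun ⟨h, h'⟩ => ⟨by omega, (key (by omega)).1 h'⟩,
      fun ⟨h, h'⟩ => ⟨by omega, (key h).2 h'⟩⟩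

/-- The Eulerian polynomial, enumerating the permutations of `[n]` by descents. -/
noncomputable def eulerianPoly (n : ℕ) : ℤ[X] := ∑ σ : Equiv.Perm (Fin n), X ^ desNum σ

/-- The enumerator of the permutations of `[n]` by descents after prepending a value `k`. -/
noncomputable def eulerianPolyCons (n k : ℕ) : ℤ[X] :=
  ∑ τ : Equiv.Perm (Fin n),
    X ^ (desNum τ + if ∃ h : 0 < n, (τ ⟨0, h⟩ : ℕ) < k then 1 else 0)

lemma eulerianPolyCons_zero (n : ℕ) : eulerianPolyCons n 0 = eulerianPoly n := by
  simp [eulerianPolyCons, eulerianPoly]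

lemma eulerianPolyCons_self (n : ℕ) :
    eulerianPolyCons n n = X * eulerianPoly n + (1 - X) * if n = 0 then 1 else 0 := by
  rcases n with _ | n
  · simp [eulerianPolyCons, eulerianPoly, desNum]
  · simp [eulerianPolyCons, eulerianPoly, Order.lt_add_one_iff, Fin.is_le, pow_succ',
      Finset.mul_sum]

lemma eulerianPolyCons_succ {n k : ℕ} (hk : k ≤ n) :
    eulerianPolyCons (n + 1) (k + 1) =
      (X - 1) * eulerianPolyCons n k + eulerianPolyCons (n + 1) k := by
  have hsplit (m : ℕ) : eulerianPolyCons (n + 1) m = ∑ l : Fin (n + 1),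
      X ^ (if (l : ℕ) < m then 1 else 0) * eulerianPolyCons n l := by
    rw [eulerianPolyCons, ← (consPerm_bijective n).sum_comp, Fintype.sum_prod_type]
    refine Finset.sum_congr rfl fun l _ => ?_
    rw [eulerianPolyCons, Finset.mul_sum]
    refine Finset.sum_congr rfl fun τ _ => ?_
    rw [desNum_consPerm, ← pow_add, add_comm]
    congr 3
    simp
  rw [hsplit, hsplit, ← sub_eq_iff_eq_add, ← Finset.sum_sub_distrib,
    Finset.sum_eq_single (⟨k, by omega⟩ : Fin (n + 1))]
  · simp
    ring
  · intro l _ hl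
    have : (l : ℕ) ≠ k := fun h => hl (Fin.ext h)
    have h : ((l : ℕ) < k + 1) ↔ (l : ℕ) < k := by omega
    simp [h]
  · simp

lemma eulerianPolyCons_add (n k : ℕ) :
    eulerianPolyCons (k + n) k = binomTransform (X - 1) (fun i => eulerianPoly (i + n)) k := by
  induction k generalizing n with
  | zero => simp [binomTransform, eulerianPolyCons_zero]
  | succ k ih =>
    rw [show k + 1 + n = k + n + 1 by ring, eulerianPolyCons_succ (by omega), ih, binomTransform,
      show k + n + 1 = k + (n + 1) by ring, ih]
    simp only [add_comm, add_left_comm]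

lemma sub_one_mul_sum_Icc_pow {R : Type*} [CommRing R] (x : R) (k : ℕ) :
    (x - 1) * ∑ a ∈ Finset.Icc 1 k, x ^ a = x ^ (k + 1) - x := by
  induction k with
  | zero => simp
  | succ k ih =>
    rw [Finset.sum_Icc_succ_top (by omega), mul_add, ih]
    ring

/-- The recurrence for the Eulerian polynomials matching the removal of the smallest set of a
chain. -/
lemma eulerianPoly_eq_one_add_sum (n : ℕ) :
    eulerianPoly n = 1 + ∑ k ∈ Finset.range (n + 1),
      (n.choose k : ℤ[X]) * ((∑ a ∈ Finset.Icc 1 (k - 1), X ^ a) * eulerianPoly (n - k)) := by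
  have hE : binomTransform (X - 1) eulerianPoly =
      fun i => X * eulerianPoly i + (1 - X) * if i = 0 then 1 else 0 := by
    funext n
    rw [← eulerianPolyCons_self]
    exact (eulerianPolyCons_add 0 n).symm
  have h := binomTransform_binomTransform 1 (X - 1) eulerianPoly n
  rw [hE, binomTransform_add, binomTransform_const_mul, binomTransform_const_mul,
    binomTransform_single, add_sub_cancel, binomTransform_eq_sum, binomTransform_eq_sum,
    Finset.mul_sum, Finset.sum_range_succ', Finset.sum_range_succ' _ n] at h
  have hX : (X - 1 : ℤ[X]) ≠ 0 := X_sub_C_ne_zero 1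
  apply mul_left_cancel₀ hX
  have hsum : (X - 1) * ∑ k ∈ Finset.range n, (n.choose (k + 1) : ℤ[X]) *
      ((∑ a ∈ Finset.Icc 1 k, X ^ a) * eulerianPoly (n - (k + 1))) =
      ∑ k ∈ Finset.range n, (n.choose (k + 1) : ℤ[X]) *
        (X ^ (k + 1) * eulerianPoly (n - (k + 1))) -
      ∑ k ∈ Finset.range n, X * ((n.choose (k + 1) : ℤ[X]) *
        (1 ^ (k + 1) * eulerianPoly (n - (k + 1)))) := by
    rw [Finset.mul_sum, ← Finset.sum_sub_distrib]
    refine Finset.sum_congr rfl fun k _ => ?_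
    linear_combination (n.choose (k + 1) : ℤ[X]) * eulerianPoly (n - (k + 1)) *
      sub_one_mul_sum_Icc_pow (X : ℤ[X]) k
  rw [Finset.sum_range_succ', mul_add, mul_add]
  simp only [Nat.add_sub_cancel]
  rw [hsum]
  simp at h ⊢
  linear_combination h

/-- Consecutive pairs (set, exponent) in an FY-basis monomial. -/
def FYStep {n : ℕ} (p q : Finset (Fin n) × ℕ) : Prop :=
  p.1 ⊂ q.1 ∧ 1 ≤ q.2 ∧ q.2 + p.1.card + 1 ≤ q.1.card

lemma exists_finset_isChain_FYStep {n : ℕ} (T : Finset (Fin n)) (b : ℕ) :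
    ∃ s : Finset (List (Finset (Fin n) × ℕ)), (∀ l, l ∈ s ↔ List.IsChain FYStep ((T, b) :: l)) ∧
      ∑ l ∈ s, (X : ℤ[X]) ^ (l.map Prod.snd).sum = eulerianPoly Tᶜ.card := by
  induction T using WellFoundedGT.induction generalizing b with
  | ind T ih =>
    choose! f hf hsum using ih
    let u : Finset (Σ _ : Finset (Fin n), Σ _ : ℕ, List (Finset (Fin n) × ℕ)) :=
      (Finset.univ.filter (T ⊂ ·)).sigma fun S =>
        (Finset.Icc 1 (S.card - T.card - 1)).sigma fun a => f S a
    let e : (Σ _ : Finset (Fin n), Σ _ : ℕ, List (Finset (Fin n) × ℕ)) →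
      List (Finset (Fin n) × ℕ) := fun p => (p.1, p.2.1) :: p.2.2
    have he : Function.Injective e := by
      rintro ⟨S, a, l⟩ ⟨S', a', l'⟩ h
      simp only [e, List.cons.injEq, Prod.mk.injEq] at h
      obtain ⟨⟨rfl, rfl⟩, rfl⟩ := h
      rfl
    refine ⟨insert [] (u.image e), ?_, ?_⟩
    · rintro (_ | ⟨⟨S, a⟩, l⟩)
      · simp
      · have : (S, a) :: l = e ⟨S, a, l⟩ := rfl
        rw [Finset.mem_insert, this, he.mem_finset_image, ← this, List.isChain_cons_cons]
        simp only [u, Finset.mem_sigma, Finset.mem_filter, Finset.mem_univ, true_and,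
          Finset.mem_Icc, FYStep, reduceCtorEq, false_or, and_assoc]
        refine and_congr_right fun hS => and_congr_right fun ha => ?_
        rw [hf S hS]
        exact and_congr_left fun _ => by omega
    · rw [Finset.sum_insert (by simp [e]), Finset.sum_image he.injOn, Finset.sum_sigma,
        eulerianPoly_eq_one_add_sum]
      simp only [List.map_nil, List.sum_nil, pow_zero]
      congr 1
      have hpow := Finset.sum_powerset_apply_card
        (fun k => (∑ a ∈ Finset.Icc 1 (k - 1), (X : ℤ[X]) ^ a) * eulerianPoly (Tᶜ.card - k)) (x := Tᶜ)
      simp only [nsmul_eq_mul] at hpow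
      rw [← hpow]
      have hinner (S : Finset (Fin n)) (hS : T ⊂ S) :
          ∑ p ∈ (Finset.Icc 1 (S.card - T.card - 1)).sigma fun a => f S a,
            (X : ℤ[X]) ^ ((e ⟨S, p⟩).map Prod.snd).sum =
          (∑ a ∈ Finset.Icc 1 ((S \ T).card - 1), X ^ a) *
            eulerianPoly (Tᶜ.card - (S \ T).card) := by
        have hcard : (S \ T).card = S.card - T.card := Finset.card_sdiff_of_subset hS.1
        have hle := Finset.card_le_card hS.1
        have hc : Tᶜ.card - (S \ T).card = Sᶜ.card := by
          rw [Finset.card_compl, Finset.card_compl, hcard]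
          omega
        rw [Finset.sum_sigma, hc, hcard, Finset.sum_mul]
        refine Finset.sum_congr rfl fun a _ => ?_
        rw [← hsum S hS a, Finset.mul_sum]
        simp [e, pow_add]
      rw [Finset.sum_congr rfl fun S hS => hinner S (Finset.mem_filter.1 hS).2]
      have himg : Tᶜ.powerset.erase ∅ = (Finset.univ.filter (T ⊂ ·)).image (· \ T) := by
        ext U
        simp only [Finset.mem_erase, Finset.mem_powerset, Finset.mem_image, Finset.mem_filter,
          Finset.mem_univ, true_and]
        constructor
        · rintro ⟨hU, hUT⟩
          have hd : Disjoint U T := (Finset.subset_compl_iff_disjoint_right).1 hUT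
          refine ⟨T ∪ U, ⟨Finset.subset_union_left, fun h => hU ?_⟩, ?_⟩
          · exact Finset.disjoint_self_iff_empty _ |>.1
              (hd.mono_right (Finset.subset_union_right.trans h))
          · rw [Finset.union_sdiff_left, hd.sdiff_eq_left]
        · rintro ⟨S, hS, rfl⟩
          exact ⟨fun h => hS.2 (Finset.sdiff_eq_empty_iff_subset.1 h), fun x => by simp⟩
      rw [← Finset.sum_erase Tᶜ.powerset (a := ∅) (by simp), himg, Finset.sum_image]
      intro S hS S' hS' h
      simp only [Finset.coe_filter, Finset.mem_univ, true_and, Set.mem_ofPred_eq] at hS hS'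
      rw [← Finset.sdiff_union_of_subset hS.1, ← Finset.sdiff_union_of_subset hS'.1]
      exact congrArg (· ∪ T) h

namespace FYMonomial

variable {n : ℕ}

/-- The list of (set, exponent) pairs of an FY-basis monomial. -/
def toList (m : FYMonomial n) : List (Finset (Fin n) × ℕ) := List.ofFn fun i => (m.F i, m.a i)

lemma toList_injective : Function.Injective (toList (n := n)) := by
  rintro ⟨k, F, a, _, _, _, _⟩ ⟨k', F', a', _, _, _, _⟩ h
  have hk : k = k' := by simpa [toList] using congrArg List.length h
  subst hk
  have h' := List.ofFn_injective h
  have hF : F = F' := funext fun i => congrArg Prod.fst (congrFun h' i)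
  have ha : a = a' := funext fun i => congrArg Prod.snd (congrFun h' i)
  subst hF ha
  rfl

lemma sum_toList (m : FYMonomial n) : (m.toList.map Prod.snd).sum = FYdeg m := by
  simp [toList, FYdeg, List.map_ofFn, List.sum_ofFn]

lemma isChain_toList (m : FYMonomial n) : List.IsChain FYStep ((∅, 0) :: m.toList) := by
  rw [List.isChain_iff_getElem]
  rintro (_ | i) hi
  · have hlen : 0 < m.len := by simpa [toList] using hi
    have h := m.a_le_first ⟨0, hlen⟩ rfl
    simp only [toList, FYStep, List.getElem_cons_zero, List.getElem_cons_succ, List.getElem_ofFn]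
    refine ⟨Finset.empty_ssubset.2 (Finset.card_pos.1 (by omega)), m.a_pos _, ?_⟩
    simpa using h
  · have hlen : i + 1 < m.len := by simpa [toList] using hi
    simp only [toList, FYStep, List.getElem_cons_succ, List.getElem_ofFn]
    exact ⟨m.chain _ _ (by simp [Fin.lt_def]), m.a_pos _, m.a_le ⟨i + 1, hlen⟩ (by simp)⟩

lemma exists_toList_eq {l : List (Finset (Fin n) × ℕ)} (h : List.IsChain FYStep ((∅, 0) :: l)) :
    ∃ m : FYMonomial n, m.toList = l := by
  have hp : List.Pairwise (fun p q : Finset (Fin n) × ℕ => p.1 ⊂ q.1) ((∅, 0) :: l) := by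
    have : IsTrans (Finset (Fin n) × ℕ) fun p q => p.1 ⊂ q.1 := ⟨fun _ _ _ => ssubset_trans⟩
    exact (h.imp fun _ _ h => h.1).pairwise
  rw [List.isChain_iff_getElem] at h
  refine ⟨⟨l.length, fun i => l[i].1, fun i => l[i].2, ?_, ?_, ?_, ?_⟩, ?_⟩
  · intro i j hij
    exact List.pairwise_iff_getElem.1 (List.pairwise_cons.1 hp).2 _ _ i.2 j.2 hij
  · intro i
    exact (h i (by simp)).2.1
  · rintro ⟨i, hi⟩ h0
    obtain rfl : i = 0 := h0
    simpa using (h 0 (by simpa using hi)).2.2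
  · rintro ⟨_ | i, hi⟩ h0
    · simp at h0
    · exact (h (i + 1) (by simpa using hi)).2.2
  · simp [toList]

end FYMonomial

lemma coeff_sum_X_pow {ι : Type*} (s : Finset ι) (f : ι → ℕ) (j : ℕ) :
    (∑ x ∈ s, (X : ℤ[X]) ^ f x).coeff j = Nat.card {x // x ∈ s ∧ f x = j} := by
  have : Nat.card {x // x ∈ s ∧ f x = j} = (s.filter (f · = j)).card :=
    Nat.subtype_card _ (by simp)
  rw [this, finsetSum_coeff, Finset.card_filter]
  simp [coeff_X_pow, eq_comm]

/-- The number of degree-`j` monomials in `FY(B_n)` equals the Eulerian number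
`A(n,j)`, the number of permutations of `[n]` with exactly `j` descents. -/
theorem card_FY_deg_eq_eulerian (n j : ℕ) :
    Nat.card {m : FYMonomial n // FYdeg m = j} =
      Nat.card {σ : Equiv.Perm (Fin n) // desNum σ = j} := by
  obtain ⟨s, hs, hsum⟩ := exists_finset_isChain_FYStep (∅ : Finset (Fin n)) 0
  have hFY : Nat.card {m : FYMonomial n // FYdeg m = j} =
      Nat.card {l // l ∈ s ∧ (l.map Prod.snd).sum = j} := by
    refine Nat.card_congr (Equiv.ofBijective
      (fun m => ⟨m.1.toList, (hs _).2 m.1.isChain_toList, m.1.sum_toList.trans m.2⟩) ⟨?_, ?_⟩)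
    · intro m m' h
      exact Subtype.ext (FYMonomial.toList_injective (congrArg Subtype.val h))
    · rintro ⟨l, hl, hj⟩
      obtain ⟨m, rfl⟩ := FYMonomial.exists_toList_eq ((hs l).1 hl)
      exact ⟨⟨m, m.sum_toList.symm.trans hj⟩, rfl⟩
  rw [Finset.compl_empty, Finset.card_univ, Fintype.card_fin] at hsum
  have hcoeff := congrArg (coeff · j) hsum
  simp only [eulerianPoly, coeff_sum_X_pow, Finset.mem_univ, true_and] at hcoeff
  rw [hFY]
  exact_mod_cast hcoeff
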